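/- arXiv:0712.3531 — 7 statements merged into one kernel-verified Lean document; each statement's English description precedes it below -/
import Mathlib

section
/- Let I > 0 and let (λ, u) be an eigenpair of the PT-symmetric operator, i.e. u : ℝ → ℂ is twice continuously differentiable on [-1,1], not identically zero on [-1,1], satisfies u''(x) + i·I·x·u(x) + λ·u(x) = 0 for all x ∈ [-1,1], and u(-1) = u(1) = 0. Then Re λ = (∫_{-1}^{1} |u'(x)|² dx) / (∫_{-1}^{1} |u(x)|² dx), Im λ = −I·(∫_{-1}^{1} x·|u(x)|² dx) / (∫_{-1}^{1} |u(x)|² dx); in particular Re λ > 0 and |Im λ| < I. -/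
open Set ComplexConjugate

/-- Integrating the eigenvalue equation against the conjugate of `u`. -/
theorem integral_norm_deriv_sq_eq (I : ℝ) (lam : ℂ) (u u' u'' : ℝ → ℂ)
    (hd1 : ∀ x ∈ Icc (-1:ℝ) 1, HasDerivAt u (u' x) x)
    (hd2 : ∀ x ∈ Icc (-1:ℝ) 1, HasDerivAt u' (u'' x) x)
    (hode : ∀ x ∈ Icc (-1:ℝ) 1,
      u'' x + Complex.I * (I : ℂ) * (x : ℂ) * u x + lam * u x = 0)
    (hbc1 : u (-1) = 0) (hbc2 : u 1 = 0) :
    ((∫ x in (-1:ℝ)..1, ‖u' x‖ ^ 2 : ℝ) : ℂ) =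
      Complex.I * I * (∫ x in (-1:ℝ)..1, x * ‖u x‖ ^ 2 : ℝ) +
        lam * (∫ x in (-1:ℝ)..1, ‖u x‖ ^ 2 : ℝ) := by
  have hI : uIcc (-1:ℝ) 1 = Icc (-1) 1 := uIcc_of_le (by norm_num)
  have hu : ContinuousOn u (uIcc (-1:ℝ) 1) := fun x hx =>
    (hd1 x (hI ▸ hx)).continuousAt.continuousWithinAt
  have hu' : ContinuousOn u' (uIcc (-1:ℝ) 1) := fun x hx =>
    (hd2 x (hI ▸ hx)).continuousAt.continuousWithinAt
  have i1 : IntervalIntegrable (fun x => ((‖u' x‖ ^ 2 : ℝ) : ℂ)) MeasureTheory.volume (-1) 1 :=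
    ContinuousOn.intervalIntegrable (by fun_prop)
  have i2 : IntervalIntegrable (fun x => Complex.I * I * ((x * ‖u x‖ ^ 2 : ℝ) : ℂ))
      MeasureTheory.volume (-1) 1 := ContinuousOn.intervalIntegrable (by fun_prop)
  have i3 : IntervalIntegrable (fun x => lam * ((‖u x‖ ^ 2 : ℝ) : ℂ))
      MeasureTheory.volume (-1) 1 := ContinuousOn.intervalIntegrable (by fun_prop)
  have hF : ∀ x ∈ uIcc (-1:ℝ) 1, HasDerivAt (fun x => u' x * conj (u x))
      (((‖u' x‖ ^ 2 : ℝ) : ℂ) - (Complex.I * I * ((x * ‖u x‖ ^ 2 : ℝ) : ℂ)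
        + lam * ((‖u x‖ ^ 2 : ℝ) : ℂ))) x := by
    intro x hx
    rw [hI] at hx
    have hconj : HasDerivAt (fun x => conj (u x)) (conj (u' x)) x := (hd1 x hx).star
    refine ((hd2 x hx).mul hconj).congr_deriv ?_
    push_cast
    rw [← Complex.mul_conj', ← Complex.mul_conj']
    linear_combination conj (u x) * hode x hx
  have key := intervalIntegral.integral_eq_sub_of_hasDerivAt hF (i1.sub (i2.add i3))
  rw [intervalIntegral.integral_sub i1 (i2.add i3), intervalIntegral.integral_add i2 i3,
    intervalIntegral.integral_const_mul, intervalIntegral.integral_const_mul,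
    intervalIntegral.integral_ofReal, intervalIntegral.integral_ofReal,
    intervalIntegral.integral_ofReal] at key
  simp only [hbc1, hbc2, map_zero, mul_zero, sub_zero] at key
  exact sub_eq_zero.mp key

/-- For `I > 0` and an eigenpair `(λ, u)` of the PT-symmetric operator
`u'' + i I x u + λ u = 0` on `[-1,1]` with Dirichlet boundary conditions,
`Re λ = ∫|u'|² / ∫|u|²`, `Im λ = -I ∫ x|u|² / ∫|u|²`, `Re λ > 0` and `|Im λ| < I`. -/
theorem stmt_0 (I : ℝ) (hI : 0 < I) (lam : ℂ) (u u' u'' : ℝ → ℂ)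
    (hd1 : ∀ x ∈ Set.Icc (-1:ℝ) 1, HasDerivAt u (u' x) x)
    (hd2 : ∀ x ∈ Set.Icc (-1:ℝ) 1, HasDerivAt u' (u'' x) x)
    (hc : ContinuousOn u'' (Set.Icc (-1:ℝ) 1))
    (hne : ∃ x ∈ Set.Icc (-1:ℝ) 1, u x ≠ 0)
    (hode : ∀ x ∈ Set.Icc (-1:ℝ) 1,
      u'' x + Complex.I * (I : ℂ) * (x : ℂ) * u x + lam * u x = 0)
    (hbc1 : u (-1) = 0) (hbc2 : u 1 = 0) :
    lam.re = (∫ x in (-1:ℝ)..1, ‖u' x‖ ^ 2) /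
        (∫ x in (-1:ℝ)..1, ‖u x‖ ^ 2) ∧
    lam.im = -I * (∫ x in (-1:ℝ)..1, x * ‖u x‖ ^ 2) /
        (∫ x in (-1:ℝ)..1, ‖u x‖ ^ 2) ∧
    0 < lam.re ∧ |lam.im| < I := by
  have hu : ContinuousOn u (Icc (-1:ℝ) 1) := fun x hx =>
    (hd1 x hx).continuousAt.continuousWithinAt
  have hu' : ContinuousOn u' (Icc (-1:ℝ) 1) := fun x hx =>
    (hd2 x hx).continuousAt.continuousWithinAt
  have hI' : uIcc (-1:ℝ) 1 = Icc (-1) 1 := uIcc_of_le (by norm_num)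
  have key := integral_norm_deriv_sq_eq I lam u u' u'' hd1 hd2 hode hbc1 hbc2
  obtain ⟨c, hc', huc⟩ := hne
  have hc1 : -1 < c := lt_of_le_of_ne hc'.1 (by rintro rfl; exact huc hbc1)
  have hc2 : c < 1 := lt_of_le_of_ne hc'.2 (by rintro rfl; exact huc hbc2)
  have huc2 : 0 < ‖u c‖ ^ 2 := by positivity
  have hN : 0 < ∫ x in (-1:ℝ)..1, ‖u x‖ ^ 2 :=
    intervalIntegral.integral_pos (by norm_num) (by fun_prop) (fun x _ => by positivity)
      ⟨c, hc', huc2⟩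
  have hD : 0 < ∫ x in (-1:ℝ)..1, ‖u' x‖ ^ 2 := by
    refine intervalIntegral.integral_pos (by norm_num) (by fun_prop) (fun x _ => by positivity) ?_
    by_contra! h
    have hzero : ∀ x ∈ Icc (-1:ℝ) 1, u' x = 0 := fun x hx => by
      have := h x hx
      exact norm_eq_zero.mp (pow_eq_zero_iff two_ne_zero |>.mp (le_antisymm this (sq_nonneg _)))
    refine huc ((constant_of_has_deriv_right_zero hu (fun x hx => ?_) c hc').trans hbc1)
    have hx' := Ico_subset_Icc_self hx
    exact hzero x hx' ▸ (hd1 x hx').hasDerivWithinAt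
  have i1 : IntervalIntegrable (fun x => ‖u x‖ ^ 2) MeasureTheory.volume (-1) 1 :=
    ContinuousOn.intervalIntegrable (by rw [hI']; fun_prop)
  have i2 : IntervalIntegrable (fun x => x * ‖u x‖ ^ 2) MeasureTheory.volume (-1) 1 :=
    ContinuousOn.intervalIntegrable (by rw [hI']; fun_prop)
  have hP : 0 < ∫ x in (-1:ℝ)..1, (‖u x‖ ^ 2 + x * ‖u x‖ ^ 2) :=
    intervalIntegral.integral_pos (by norm_num) (by fun_prop)
      (fun x hx => by nlinarith [hx.1, sq_nonneg ‖u x‖]) ⟨c, hc', by nlinarith⟩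
  have hM : 0 < ∫ x in (-1:ℝ)..1, (‖u x‖ ^ 2 - x * ‖u x‖ ^ 2) :=
    intervalIntegral.integral_pos (by norm_num) (by fun_prop)
      (fun x hx => by nlinarith [hx.2, sq_nonneg ‖u x‖]) ⟨c, hc', by nlinarith⟩
  rw [intervalIntegral.integral_add i1 i2] at hP
  rw [intervalIntegral.integral_sub i1 i2] at hM
  generalize (∫ x in (-1:ℝ)..1, ‖u x‖ ^ 2) = N at *
  generalize (∫ x in (-1:ℝ)..1, ‖u' x‖ ^ 2) = D at *
  generalize (∫ x in (-1:ℝ)..1, x * ‖u x‖ ^ 2) = X at *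
  have hre : D = lam.re * N := by simpa using congrArg Complex.re key
  have him : 0 = I * X + lam.im * N := by simpa using congrArg Complex.im key
  have hre' : lam.re = D / N := by rw [hre]; field_simp
  have him' : lam.im = -I * X / N := by rw [eq_div_iff hN.ne']; linarith
  refine ⟨hre', him', hre' ▸ div_pos hD hN, ?_⟩
  rw [him', abs_lt, lt_div_iff₀ hN, div_lt_iff₀ hN]
  constructor <;> nlinarith
end

section
/- For every function y : ℝ → ℂ that is continuously differentiable on [-1,1] with y(-1) = 0, one has ∫_{-1}^{1} |y(x)|⁶ dx ≤ 4 · (∫_{-1}^{1} |y(x)|² dx)² · (∫_{-1}^{1} |y'(x)|² dx). -/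
open MeasureTheory in
/-- Cauchy–Schwarz inequality for interval integrals of continuous real functions. -/
theorem sq_intervalIntegral_mul_le {a b : ℝ} (hab : a ≤ b) {f g : ℝ → ℝ}
    (hf : ContinuousOn f (Set.Icc a b)) (hg : ContinuousOn g (Set.Icc a b)) :
    (∫ x in a..b, f x * g x) ^ 2 ≤ (∫ x in a..b, f x ^ 2) * ∫ x in a..b, g x ^ 2 := by
  have hff : IntervalIntegrable (fun x => f x ^ 2) volume a b :=
    (hf.pow 2).intervalIntegrable_of_Icc hab
  have hgg : IntervalIntegrable (fun x => g x ^ 2) volume a b :=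
    (hg.pow 2).intervalIntegrable_of_Icc hab
  have hfg : IntervalIntegrable (fun x => f x * g x) volume a b :=
    (hf.mul hg).intervalIntegrable_of_Icc hab
  have h_nonneg : ∀ t : ℝ, 0 ≤ (∫ x in a..b, f x ^ 2) * (t * t)
      + (2 * ∫ x in a..b, f x * g x) * t + ∫ x in a..b, g x ^ 2 := by
    intro t
    have h : 0 ≤ ∫ x in a..b, (t * f x + g x) ^ 2 :=
      intervalIntegral.integral_nonneg hab fun x _ => sq_nonneg _
    have h_expand : ∫ x in a..b, (t * f x + g x) ^ 2
        = ∫ x in a..b, ((t * t) * f x ^ 2 + (2 * t) * (f x * g x) + g x ^ 2) :=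
      intervalIntegral.integral_congr fun x _ => by ring
    rw [h_expand, intervalIntegral.integral_add ((hff.const_mul _).add (hfg.const_mul _)) hgg,
      intervalIntegral.integral_add (hff.const_mul _) (hfg.const_mul _),
      intervalIntegral.integral_const_mul, intervalIntegral.integral_const_mul] at h
    linarith
  have h := discrim_le_zero h_nonneg
  rw [discrim] at h
  linarith

open MeasureTheory in
/-- A `C¹` function vanishing at the left end point satisfies
`‖y‖⁴ ≤ 4 (∫ ‖y‖²) (∫ ‖y'‖²)` pointwise. -/
theorem norm_pow_four_le_of_hasDerivAt {a b : ℝ} {y y' : ℝ → ℂ}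
    (hd : ∀ x ∈ Set.Icc a b, HasDerivAt y (y' x) x)
    (hc : ContinuousOn y' (Set.Icc a b)) (ha : y a = 0) {x : ℝ} (hx : x ∈ Set.Icc a b) :
    ‖y x‖ ^ 4 ≤ 4 * (∫ t in a..b, ‖y t‖ ^ 2) * ∫ t in a..b, ‖y' t‖ ^ 2 := by
  have hab : a ≤ b := hx.1.trans hx.2
  have hy : ContinuousOn y (Set.Icc a b) := fun t ht =>
    (hd t ht).continuousAt.continuousWithinAt
  have h_sub : Set.Icc a x ⊆ Set.Icc a b := Set.Icc_subset_Icc_right hx.2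
  have h_ftc : ∫ t in a..x, 2 * (y t * y' t) = y x ^ 2 := by
    rw [intervalIntegral.integral_eq_sub_of_hasDerivAt (f := fun t => y t ^ 2), ha]
    · simp
    · intro t ht
      rw [Set.uIcc_of_le hx.1] at ht
      exact ((hd t (h_sub ht)).pow 2).congr_deriv (by norm_num; ring)
    · exact ((continuousOn_const.mul (hy.mul hc)).mono h_sub).intervalIntegrable_of_Icc hx.1
  have h_int : IntervalIntegrable (fun t => ‖y t‖ * ‖y' t‖) volume a b :=
    (hy.norm.mul hc.norm).intervalIntegrable_of_Icc hab
  have h_sq : ‖y x‖ ^ 2 ≤ 2 * ∫ t in a..b, ‖y t‖ * ‖y' t‖ := by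
    calc ‖y x‖ ^ 2 = ‖∫ t in a..x, 2 * (y t * y' t)‖ := by rw [h_ftc, norm_pow]
      _ ≤ ∫ t in a..x, ‖2 * (y t * y' t)‖ :=
        intervalIntegral.norm_integral_le_integral_norm hx.1
      _ = 2 * ∫ t in a..x, ‖y t‖ * ‖y' t‖ := by
        simp only [norm_mul, Complex.norm_ofNat, intervalIntegral.integral_const_mul]
      _ ≤ 2 * ∫ t in a..b, ‖y t‖ * ‖y' t‖ := by
        gcongr
        exact intervalIntegral.integral_mono_interval le_rfl hx.1 hx.2
          (Filter.Eventually.of_forall fun t => by positivity) h_int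
  calc ‖y x‖ ^ 4 = (‖y x‖ ^ 2) ^ 2 := by ring
    _ ≤ (2 * ∫ t in a..b, ‖y t‖ * ‖y' t‖) ^ 2 := by gcongr
    _ = 4 * (∫ t in a..b, ‖y t‖ * ‖y' t‖) ^ 2 := by ring
    _ ≤ 4 * ((∫ t in a..b, ‖y t‖ ^ 2) * ∫ t in a..b, ‖y' t‖ ^ 2) := by
      gcongr
      exact sq_intervalIntegral_mul_le hab hy.norm hc.norm
    _ = _ := by ring

/-- For `y` continuously differentiable on `[-1,1]` with `y(-1) = 0`,
`∫|y|⁶ ≤ 4 (∫|y|²)² (∫|y'|²)`. -/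
theorem stmt_5 (y y' : ℝ → ℂ)
    (hd : ∀ x ∈ Set.Icc (-1:ℝ) 1, HasDerivAt y (y' x) x)
    (hc : ContinuousOn y' (Set.Icc (-1:ℝ) 1))
    (hbc : y (-1) = 0) :
    ∫ x in (-1:ℝ)..1, ‖y x‖ ^ 6 ≤
      4 * (∫ x in (-1:ℝ)..1, ‖y x‖ ^ 2) ^ 2 *
        (∫ x in (-1:ℝ)..1, ‖y' x‖ ^ 2) := by
  have hy : ContinuousOn y (Set.Icc (-1) 1) := fun t ht =>
    (hd t ht).continuousAt.continuousWithinAt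
  have h_le : (-1 : ℝ) ≤ 1 := by norm_num
  set M := 4 * (∫ x in (-1:ℝ)..1, ‖y x‖ ^ 2) * ∫ x in (-1:ℝ)..1, ‖y' x‖ ^ 2 with hM
  calc ∫ x in (-1:ℝ)..1, ‖y x‖ ^ 6 ≤ ∫ x in (-1:ℝ)..1, M * ‖y x‖ ^ 2 := by
        refine intervalIntegral.integral_mono_on h_le
          ((hy.norm.pow 6).intervalIntegrable_of_Icc h_le)
          ((continuousOn_const.mul (hy.norm.pow 2)).intervalIntegrable_of_Icc h_le)
          fun x hx => ?_
        calc ‖y x‖ ^ 6 = ‖y x‖ ^ 4 * ‖y x‖ ^ 2 := by ring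
          _ ≤ M * ‖y x‖ ^ 2 := by
            gcongr
            exact norm_pow_four_le_of_hasDerivAt hd hc hbc hx
    _ = M * ∫ x in (-1:ℝ)..1, ‖y x‖ ^ 2 := intervalIntegral.integral_const_mul _ _
    _ = _ := by rw [hM]; ring
end

section
/- Let I, Γ ∈ ℝ and T > 0. Suppose ψ : ℝ × ℝ → ℂ is such that for each t ∈ [0,T] the map x ↦ ψ(x,t) is twice continuously differentiable on [-1,1] with ψ(-1,t) = ψ(1,t) = 0, the map t ↦ ψ(x,t) is differentiable for each x ∈ [-1,1], and for all (x,t) ∈ [-1,1] × [0,T] one has ∂_t ψ(x,t) = ∂_x² ψ(x,t) + i·I·x·ψ(x,t) + Γ·ψ(x,t) + N[ψ(·,t)](x). Then the PT-conjugate φ(x,t) := conj(ψ(-x,t)) satisfies the same system: φ(-1,t) = φ(1,t) = 0 and ∂_t φ(x,t) = ∂_x² φ(x,t) + i·I·x·φ(x,t) + Γ·φ(x,t) + N[φ(·,t)](x) for all (x,t) ∈ [-1,1] × [0,T]. -/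
/-- The Ginzburg–Landau nonlinearity
`N[y](x) = -|y(x)|² y(x) + (1/2) y(x) ∫₀ˣ (y conj(y') - conj(y) y') ds`,
expressed with an explicit derivative function `y'`. -/
noncomputable def GLNonlin (y y' : ℝ → ℂ) (x : ℝ) : ℂ :=
  -((‖y x‖ : ℂ)) ^ 2 * y x +
    (1 / 2 : ℂ) * y x *
      ∫ s in (0:ℝ)..x, (y s * (starRingEnd ℂ) (y' s) - (starRingEnd ℂ) (y s) * y' s)

/-- The nonlinearity commutes with the PT-conjugation `y ↦ conj (y (-·))`. -/
theorem GLNonlin_conj_comp_neg (y y' : ℝ → ℂ) (x : ℝ) :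
    GLNonlin (fun z => (starRingEnd ℂ) (y (-z))) (fun z => -(starRingEnd ℂ) (y' (-z))) x =
      (starRingEnd ℂ) (GLNonlin y y' (-x)) := by
  have key : (∫ s in (0:ℝ)..x, ((starRingEnd ℂ) (y (-s)) *
        (starRingEnd ℂ) (-(starRingEnd ℂ) (y' (-s))) -
        (starRingEnd ℂ) ((starRingEnd ℂ) (y (-s))) * -(starRingEnd ℂ) (y' (-s)))) =
      (starRingEnd ℂ) (∫ s in (0:ℝ)..(-x),
        (y s * (starRingEnd ℂ) (y' s) - (starRingEnd ℂ) (y s) * y' s)) := by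
    rw [← intervalIntegral.intervalIntegral_conj, intervalIntegral.integral_symm,
      ← neg_zero, ← intervalIntegral.integral_comp_neg, ← intervalIntegral.integral_neg, neg_zero]
    congr 1 with s
    simp only [map_sub, map_mul, map_neg, Complex.conj_conj]
    ring
  simp only [GLNonlin]
  rw [key]
  simp [Complex.conj_ofNat]

/-- Derivative of the PT-conjugate of a function. -/
theorem HasDerivAt.conj_comp_neg {f : ℝ → ℂ} {f' : ℂ} {x : ℝ} (h : HasDerivAt f f' (-x)) :
    HasDerivAt (fun z => (starRingEnd ℂ) (f (-z))) (-(starRingEnd ℂ) f') x := by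
  simpa using (h.scomp x (hasDerivAt_neg x)).star

/-- If `ψ` solves the gauge-reduced TDGL equation
`ψ_t = ψ_xx + i I x ψ + Γ ψ + N[ψ(·,t)]` on `[-1,1] × [0,T]` with Dirichlet boundary
conditions, then the PT-conjugate `φ(x,t) := conj (ψ(-x,t))` solves the same system. -/
theorem stmt_9 (I Γ T : ℝ) (hT : 0 < T) (ψ ψx ψxx ψt : ℝ → ℝ → ℂ)
    (hx : ∀ t ∈ Set.Icc (0:ℝ) T, ∀ x ∈ Set.Icc (-1:ℝ) 1,
      HasDerivAt (fun z => ψ z t) (ψx x t) x)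
    (hxx : ∀ t ∈ Set.Icc (0:ℝ) T, ∀ x ∈ Set.Icc (-1:ℝ) 1,
      HasDerivAt (fun z => ψx z t) (ψxx x t) x)
    (hcont : ∀ t ∈ Set.Icc (0:ℝ) T, ContinuousOn (fun z => ψxx z t) (Set.Icc (-1:ℝ) 1))
    (ht : ∀ x ∈ Set.Icc (-1:ℝ) 1, ∀ t ∈ Set.Icc (0:ℝ) T,
      HasDerivAt (fun s => ψ x s) (ψt x t) t)
    (hbc : ∀ t ∈ Set.Icc (0:ℝ) T, ψ (-1) t = 0 ∧ ψ 1 t = 0)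
    (hpde : ∀ x ∈ Set.Icc (-1:ℝ) 1, ∀ t ∈ Set.Icc (0:ℝ) T,
      ψt x t = ψxx x t + Complex.I * (I : ℂ) * (x : ℂ) * ψ x t + (Γ : ℂ) * ψ x t +
        GLNonlin (fun z => ψ z t) (fun z => ψx z t) x) :
    let φ : ℝ → ℝ → ℂ := fun x t => (starRingEnd ℂ) (ψ (-x) t)
    let φx : ℝ → ℝ → ℂ := fun x t => -(starRingEnd ℂ) (ψx (-x) t)
    let φxx : ℝ → ℝ → ℂ := fun x t => (starRingEnd ℂ) (ψxx (-x) t)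
    let φt : ℝ → ℝ → ℂ := fun x t => (starRingEnd ℂ) (ψt (-x) t)
    (∀ t ∈ Set.Icc (0:ℝ) T, φ (-1) t = 0 ∧ φ 1 t = 0) ∧
    (∀ t ∈ Set.Icc (0:ℝ) T, ∀ x ∈ Set.Icc (-1:ℝ) 1,
      HasDerivAt (fun z => φ z t) (φx x t) x) ∧
    (∀ t ∈ Set.Icc (0:ℝ) T, ∀ x ∈ Set.Icc (-1:ℝ) 1,
      HasDerivAt (fun z => φx z t) (φxx x t) x) ∧
    (∀ t ∈ Set.Icc (0:ℝ) T, ContinuousOn (fun z => φxx z t) (Set.Icc (-1:ℝ) 1)) ∧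
    (∀ x ∈ Set.Icc (-1:ℝ) 1, ∀ t ∈ Set.Icc (0:ℝ) T,
      HasDerivAt (fun s => φ x s) (φt x t) t) ∧
    (∀ x ∈ Set.Icc (-1:ℝ) 1, ∀ t ∈ Set.Icc (0:ℝ) T,
      φt x t = φxx x t + Complex.I * (I : ℂ) * (x : ℂ) * φ x t + (Γ : ℂ) * φ x t +
        GLNonlin (fun z => φ z t) (fun z => φx z t) x) := by
  have neg_mem : ∀ x ∈ Set.Icc (-1:ℝ) 1, -x ∈ Set.Icc (-1:ℝ) 1 := fun x hx =>
    ⟨by linarith [hx.2], by linarith [hx.1]⟩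
  intro φ φx φxx φt
  refine ⟨fun t h => ⟨?_, ?_⟩, fun t h x hx' => (hx t h _ (neg_mem x hx')).conj_comp_neg,
    fun t h x hx' => ?_, fun t h => ?_, fun x hx' t h => (ht _ (neg_mem x hx') t h).star,
    fun x hx' t h => ?_⟩
  · simp [φ, (hbc t h).2]
  · simp [φ, (hbc t h).1]
  · simpa only [φx, φxx, neg_neg] using (hxx t h _ (neg_mem x hx')).conj_comp_neg.fun_neg
  · exact Complex.continuous_conj.comp_continuousOn
      ((hcont t h).comp continuous_neg.continuousOn neg_mem)
  · simp only [φ, φx, φxx, φt]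
    rw [GLNonlin_conj_comp_neg (fun z => ψ z t) (fun z => ψx z t), hpde _ (neg_mem x hx') t h]
    simp only [map_add, map_mul, map_neg, Complex.conj_I, Complex.conj_ofReal, Complex.ofReal_neg]
    ring
end

section
/- Let χ₁₁, χ₁₂ ∈ ℂ and let α₁, α₂ : [0,∞) → ℂ be differentiable solutions of the amplitude system α₁' = α₁ + (χ₁₁·|α₁|² + χ₁₂·|α₂|²)·α₁, α₂' = α₂ + (conj(χ₁₁)·|α₂|² + conj(χ₁₂)·|α₁|²)·α₂, with α₁(τ) ≠ 0 and α₂(τ) ≠ 0 for all τ ≥ 0. Then the Riccati ratio r(τ) := |α₁(τ)|/|α₂(τ)| is differentiable and satisfies r'(τ) = −Re(χ₁₂ − χ₁₁)·|α₂(τ)|²·r(τ)·(r(τ)² − 1) for all τ ≥ 0. -/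
/-- If `f` has derivative `c * f x` at `x` and `f x ≠ 0`, then `‖f‖` has derivative
`Re c * ‖f x‖` at `x`. -/
theorem hasDerivAt_norm_of_eq_mul_self {f : ℝ → ℂ} {c : ℂ} {x : ℝ}
    (hf : HasDerivAt f (c * f x) x) (hx : f x ≠ 0) :
    HasDerivAt (fun s => ‖f s‖) (c.re * ‖f x‖) x := by
  have hpos : ‖f x‖ ≠ 0 := norm_ne_zero_iff.mpr hx
  have h := hf.norm_sq.sqrt (pow_ne_zero 2 hpos)
  simp only [Real.sqrt_sq (norm_nonneg _)] at h
  convert h using 1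
  have hinner : inner ℝ (f x) (c * f x) = c.re * ‖f x‖ ^ 2 := by
    rw [Complex.inner, ← Complex.normSq_eq_norm_sq, Complex.normSq_apply]
    simp only [Complex.mul_re, Complex.mul_im, Complex.conj_re, Complex.conj_im]
    ring
  rw [hinner]
  field_simp

/-- For nowhere-vanishing solutions of the amplitude system, the Riccati
ratio `r = |α₁|/|α₂|` satisfies `r' = -Re(χ₁₂ - χ₁₁) |α₂|² r (r² - 1)`. -/
theorem stmt_11 (χ₁₁ χ₁₂ : ℂ) (α₁ α₂ : ℝ → ℂ)
    (h₁ : ∀ τ : ℝ, 0 ≤ τ → HasDerivAt α₁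
      (α₁ τ + (χ₁₁ * (‖α₁ τ‖ : ℂ) ^ 2 + χ₁₂ * (‖α₂ τ‖ : ℂ) ^ 2) * α₁ τ) τ)
    (h₂ : ∀ τ : ℝ, 0 ≤ τ → HasDerivAt α₂
      (α₂ τ + ((starRingEnd ℂ) χ₁₁ * (‖α₂ τ‖ : ℂ) ^ 2 +
        (starRingEnd ℂ) χ₁₂ * (‖α₁ τ‖ : ℂ) ^ 2) * α₂ τ) τ)
    (hne₁ : ∀ τ : ℝ, 0 ≤ τ → α₁ τ ≠ 0)
    (hne₂ : ∀ τ : ℝ, 0 ≤ τ → α₂ τ ≠ 0) :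
    ∀ τ : ℝ, 0 ≤ τ →
      HasDerivAt (fun s => ‖α₁ s‖ / ‖α₂ s‖)
        (-(χ₁₂ - χ₁₁).re * ‖α₂ τ‖ ^ 2 *
          (‖α₁ τ‖ / ‖α₂ τ‖) *
          ((‖α₁ τ‖ / ‖α₂ τ‖) ^ 2 - 1)) τ := by
  intro τ hτ
  have hpos₂ : ‖α₂ τ‖ ≠ 0 := norm_ne_zero_iff.mpr (hne₂ τ hτ)
  have hd₁ := h₁ τ hτ
  have hd₂ := h₂ τ hτ
  rw [← one_add_mul] at hd₁ hd₂
  have hr := (hasDerivAt_norm_of_eq_mul_self hd₁ (hne₁ τ hτ)).fun_div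
    (hasDerivAt_norm_of_eq_mul_self hd₂ (hne₂ τ hτ)) hpos₂
  refine hr.congr_deriv ?_
  simp only [← Complex.ofReal_pow, Complex.add_re, Complex.sub_re, Complex.one_re,
    Complex.re_mul_ofReal, Complex.conj_re]
  field_simp
  ring
end

section
/- Let χ₁₁, χ₁₂ ∈ ℂ with Re(χ₁₂ − χ₁₁) > 0, and let α₁, α₂ : [0,∞) → ℂ be differentiable solutions of the amplitude system α₁' = α₁ + (χ₁₁·|α₁|² + χ₁₂·|α₂|²)·α₁, α₂' = α₂ + (conj(χ₁₁)·|α₂|² + conj(χ₁₂)·|α₁|²)·α₂, with α₁(τ) ≠ 0 and α₂(τ) ≠ 0 for all τ ≥ 0. Suppose moreover there is m > 0 with |α₂(τ)|² ≥ m for all τ ≥ 0. Then the ratio r(τ) := |α₁(τ)|/|α₂(τ)| converges to 1 at an exponential rate: there exist C > 0 and δ > 0 such that |r(τ) − 1| ≤ C·e^{−δτ} for all τ ≥ 0. -/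
/-- If `α' = α + c α` then `(|α|²)' = 2 (1 + Re c) |α|²`. -/
lemma hasDerivAt_norm_sq_of_linear_growth {α : ℝ → ℂ} {c : ℂ} {τ : ℝ}
    (h : HasDerivAt α (α τ + c * α τ) τ) :
    HasDerivAt (fun t => ‖α t‖ ^ 2) (2 * (1 + c.re) * ‖α τ‖ ^ 2) τ := by
  refine h.norm_sq.congr_deriv ?_
  rw [Complex.inner, ← Complex.normSq_eq_norm_sq, Complex.normSq_apply]
  simp only [Complex.mul_re, Complex.mul_im, Complex.add_re, Complex.add_im, Complex.conj_re,
    Complex.conj_im]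
  ring

/-- A differential inequality `V' ≤ -c V` on `[0, ∞)` gives exponential decay. -/
lemma le_mul_exp_of_hasDerivAt_le {V V' : ℝ → ℝ} {c : ℝ}
    (hV : ∀ t, 0 ≤ t → HasDerivAt V (V' t) t) (hle : ∀ t, 0 ≤ t → V' t ≤ -c * V t)
    {t : ℝ} (ht : 0 ≤ t) : V t ≤ V 0 * Real.exp (-c * t) := by
  have hd : ∀ x, 0 ≤ x → HasDerivAt (fun y => V y * Real.exp (c * y))
      ((V' x + c * V x) * Real.exp (c * x)) x := fun x hx =>
    ((hV x hx).mul ((hasDerivAt_id x).const_mul c).exp).congr_deriv (by simp; ring)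
  have hanti : AntitoneOn (fun y => V y * Real.exp (c * y)) (Set.Ici 0) := by
    refine antitoneOn_of_deriv_nonpos (convex_Ici 0)
      (fun x hx => (hd x hx).continuousAt.continuousWithinAt)
      (fun x hx => (hd x (interior_subset hx)).differentiableAt.differentiableWithinAt)
      (fun x hx => ?_)
    have hx' : 0 ≤ x := interior_subset hx
    rw [(hd x hx').deriv]
    exact mul_nonpos_of_nonpos_of_nonneg (by linarith [hle x hx']) (Real.exp_pos _).le
  have h := hanti (Set.self_mem_Ici) (Set.mem_Ici.2 ht) ht
  simp only [mul_zero, Real.exp_zero, mul_one] at h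
  rw [neg_mul, Real.exp_neg, ← div_eq_mul_inv, le_div_iff₀ (Real.exp_pos _)]
  exact h

lemma sq_div_sub_one_le {x y : ℝ} (hx : 0 < x) (hy : 0 < y) :
    (x / y - 1) ^ 2 ≤ (x ^ 2 - y ^ 2) ^ 2 / (x ^ 2 * y ^ 2) := by
  have h : (x ^ 2 - y ^ 2) ^ 2 / (x ^ 2 * y ^ 2) = (x / y - 1) ^ 2 * (1 + y / x) ^ 2 := by
    field_simp
    ring
  rw [h]
  have : 0 < y / x := div_pos hy hx
  exact le_mul_of_one_le_right (sq_nonneg _) (one_le_pow₀ (by linarith))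

/-- If `Re(χ₁₂ - χ₁₁) > 0` and `|α₂|²` stays bounded below by `m > 0`,
then the ratio `r = |α₁|/|α₂|` of a nowhere-vanishing solution of the amplitude system
converges to `1` at an exponential rate. -/
theorem stmt_12 (χ₁₁ χ₁₂ : ℂ) (hχ : 0 < (χ₁₂ - χ₁₁).re) (α₁ α₂ : ℝ → ℂ)
    (h₁ : ∀ τ : ℝ, 0 ≤ τ → HasDerivAt α₁
      (α₁ τ + (χ₁₁ * (‖α₁ τ‖ : ℂ) ^ 2 + χ₁₂ * (‖α₂ τ‖ : ℂ) ^ 2) * α₁ τ) τ)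
    (h₂ : ∀ τ : ℝ, 0 ≤ τ → HasDerivAt α₂
      (α₂ τ + ((starRingEnd ℂ) χ₁₁ * (‖α₂ τ‖ : ℂ) ^ 2 +
        (starRingEnd ℂ) χ₁₂ * (‖α₁ τ‖ : ℂ) ^ 2) * α₂ τ) τ)
    (hne₁ : ∀ τ : ℝ, 0 ≤ τ → α₁ τ ≠ 0)
    (hne₂ : ∀ τ : ℝ, 0 ≤ τ → α₂ τ ≠ 0)
    (m : ℝ) (hm : 0 < m)
    (hlow : ∀ τ : ℝ, 0 ≤ τ → m ≤ ‖α₂ τ‖ ^ 2) :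
    ∃ C > 0, ∃ δ > 0, ∀ τ : ℝ, 0 ≤ τ →
      |‖α₁ τ‖ / ‖α₂ τ‖ - 1| ≤ C * Real.exp (-δ * τ) := by
  set k := (χ₁₂ - χ₁₁).re with hk
  have hA : ∀ t, 0 ≤ t → 0 < ‖α₁ t‖ := fun t ht => norm_pos_iff.2 (hne₁ t ht)
  have hB : ∀ t, 0 ≤ t → 0 < ‖α₂ t‖ := fun t ht => norm_pos_iff.2 (hne₂ t ht)
  -- `V = (s - 1)² / s` with `s = |α₁|² / |α₂|²` satisfies `V' = -2 k (|α₁|² + |α₂|²) V`.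
  let V : ℝ → ℝ := fun t => (‖α₁ t‖ ^ 2 - ‖α₂ t‖ ^ 2) ^ 2 / (‖α₁ t‖ ^ 2 * ‖α₂ t‖ ^ 2)
  have hVnonneg : ∀ t, 0 ≤ V t := fun t => by positivity
  have hV : ∀ t, 0 ≤ t →
      HasDerivAt V (-(2 * k * (‖α₁ t‖ ^ 2 + ‖α₂ t‖ ^ 2)) * V t) t := by
    intro t ht
    have d₁ := hasDerivAt_norm_sq_of_linear_growth (h₁ t ht)
    have d₂ := hasDerivAt_norm_sq_of_linear_growth (h₂ t ht)
    have hA' := (hA t ht).ne'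
    have hB' := (hB t ht).ne'
    refine (((d₁.sub d₂).pow 2).div (d₁.mul d₂) (by simp [hA', hB'])).congr_deriv ?_
    simp only [← Complex.ofReal_pow, Complex.add_re, Complex.re_mul_ofReal, Complex.conj_re,
      Pi.sub_apply, Pi.mul_apply, Pi.pow_apply, V, hk, Complex.sub_re]
    field_simp
    ring
  have hdecay : ∀ t, 0 ≤ t → V t ≤ V 0 * Real.exp (-(2 * (k * m)) * t) := fun t ht =>
    le_mul_exp_of_hasDerivAt_le hV (fun x hx => by
      refine mul_le_mul_of_nonneg_right ?_ (hVnonneg x)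
      nlinarith [hlow x hx, sq_nonneg ‖α₁ x‖]) ht
  refine ⟨√(V 0) + 1, by positivity, k * m, mul_pos hχ hm, fun τ hτ => ?_⟩
  have hsq : (‖α₁ τ‖ / ‖α₂ τ‖ - 1) ^ 2 ≤ (√(V 0) * Real.exp (-(k * m) * τ)) ^ 2 := by
    rw [mul_pow, Real.sq_sqrt (hVnonneg 0), ← Real.exp_nat_mul, Nat.cast_ofNat, ← mul_assoc,
      mul_neg]
    exact (sq_div_sub_one_le (hA τ hτ) (hB τ hτ)).trans (hdecay τ hτ)
  refine (abs_le_of_sq_le_sq hsq (by positivity)).trans ?_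
  gcongr
  linarith
end

section
/- Let χ ∈ ℂ with Re χ < 0 and let α : [0,∞) → ℂ be differentiable with α'(τ) = α(τ) + χ·|α(τ)|²·α(τ) for all τ ≥ 0 and α(0) ≠ 0. Then α(τ) ≠ 0 for all τ ≥ 0, and |α(τ)| → 1/√(−Re χ) as τ → ∞. -/
/-- The squared modulus of a solution of `α' = α + χ|α|²α` satisfies a logistic equation. -/
theorem hasDerivAt_normSq_of_amplitude {χ : ℂ} {α : ℝ → ℂ} {τ : ℝ}
    (h : HasDerivAt α (α τ + χ * (‖α τ‖ : ℂ) ^ 2 * α τ) τ) :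
    HasDerivAt (fun t => ‖α t‖ ^ 2) (2 * ‖α τ‖ ^ 2 + 2 * χ.re * (‖α τ‖ ^ 2) ^ 2) τ := by
  refine h.norm_sq.congr_deriv ?_
  have hn : ‖α τ‖ ^ 2 = (α τ).re ^ 2 + (α τ).im ^ 2 := by
    rw [Complex.sq_norm, Complex.normSq_apply]; ring
  rw [Complex.inner, ← Complex.ofReal_pow, hn]
  simp only [Complex.mul_re, Complex.mul_im, Complex.add_re, Complex.add_im, Complex.conj_re,
    Complex.conj_im, Complex.ofReal_re, Complex.ofReal_im]
  ring

/-- A nonnegative solution of `r' = 2r - 2cr²` with `c ≥ 0` and `r 0 ≠ 0` is the explicit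
logistic function. -/
theorem logistic_mul_eq_one {c : ℝ} (hc : 0 ≤ c) {r : ℝ → ℝ} (hr : ∀ t, 0 ≤ r t)
    (h : ∀ t, 0 ≤ t → HasDerivAt r (2 * r t - 2 * c * r t ^ 2) t) (h0 : r 0 ≠ 0)
    {t : ℝ} (ht : 0 ≤ t) :
    r t * (c + ((r 0)⁻¹ - c) * Real.exp (-2 * t)) = 1 := by
  set g : ℝ → ℝ := fun t => c + ((r 0)⁻¹ - c) * Real.exp (-2 * t) with hg
  have hg' (s : ℝ) : HasDerivAt g (-2 * (g s - c)) s := by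
    have := ((((hasDerivAt_id s).const_mul (-2)).exp).const_mul ((r 0)⁻¹ - c)).const_add c
    refine this.congr_deriv ?_
    simp only [hg, id]
    ring
  have hw (s : ℝ) (hs : 0 ≤ s) : HasDerivAt (fun t => (r t * g t - 1) ^ 2)
      (-(4 * c * r s * (r s * g s - 1) ^ 2)) s := by
    refine ((((h s hs).mul (hg' s)).sub_const 1).pow 2).congr_deriv ?_
    simp only [Pi.mul_apply]
    push_cast
    ring
  have hanti : AntitoneOn (fun t => (r t * g t - 1) ^ 2) (Set.Ici 0) := by
    refine antitoneOn_of_deriv_nonpos (convex_Ici 0)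
      (fun s hs => (hw s hs).continuousAt.continuousWithinAt) ?_ ?_
    · intro s hs
      exact (hw s (interior_subset hs)).differentiableAt.differentiableWithinAt
    · intro s hs
      rw [(hw s (interior_subset hs)).deriv]
      have := hr s
      exact neg_nonpos.2 (by positivity)
  have hle := hanti (Set.mem_Ici.2 le_rfl) (Set.mem_Ici.2 ht) ht
  have hinit : r 0 * g 0 = 1 := by simp [hg, h0]
  simp only [hinit, sub_self] at hle
  have hsq : (r t * g t - 1) ^ 2 = 0 := le_antisymm (by simpa using hle) (sq_nonneg _)
  exact sub_eq_zero.1 (pow_eq_zero_iff two_ne_zero |>.1 hsq)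

/-- For `Re χ < 0`, any solution of the single-mode amplitude equation
`α' = α + χ|α|²α` on `[0,∞)` with `α(0) ≠ 0` never vanishes and satisfies
`|α(τ)| → 1/√(-Re χ)` as `τ → ∞`. -/
theorem stmt_13 (χ : ℂ) (hχ : χ.re < 0) (α : ℝ → ℂ)
    (h : ∀ τ : ℝ, 0 ≤ τ →
      HasDerivAt α (α τ + χ * (‖α τ‖ : ℂ) ^ 2 * α τ) τ)
    (h0 : α 0 ≠ 0) :
    (∀ τ : ℝ, 0 ≤ τ → α τ ≠ 0) ∧
    Filter.Tendsto (fun τ => ‖α τ‖) Filter.atTop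
      (nhds (1 / Real.sqrt (-χ.re))) := by
  have key (τ : ℝ) (hτ : 0 ≤ τ) :=
    logistic_mul_eq_one (c := -χ.re) (r := fun t => ‖α t‖ ^ 2) (by linarith)
      (fun t => by positivity)
      (fun t ht => (hasDerivAt_normSq_of_amplitude (h t ht)).congr_deriv (by ring))
      (by simpa using h0) hτ
  refine ⟨fun τ hτ hz => by simpa [hz] using key τ hτ, ?_⟩
  have hexp : Filter.Tendsto (fun τ : ℝ => Real.exp (-2 * τ)) Filter.atTop (nhds 0) :=
    Real.tendsto_exp_atBot.comp (Filter.tendsto_id.const_mul_atTop_of_neg (by norm_num))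
  have hlim := (((hexp.const_mul ((‖α 0‖ ^ 2)⁻¹ - -χ.re)).const_add (-χ.re)).inv₀
    (by simpa using hχ.ne)).sqrt
  rw [mul_zero, add_zero, Real.sqrt_inv] at hlim
  rw [one_div]
  refine hlim.congr' ?_
  filter_upwards [Filter.eventually_ge_atTop 0] with τ hτ
  rw [← eq_inv_of_mul_eq_one_left (key τ hτ), Real.sqrt_sq (norm_nonneg _)]
end

section
/- Let χ₁₁, χ₁₂ ∈ ℂ with Re(χ₁₁ + χ₁₂) < 0, and set χ̃ := −(χ₁₁ + χ₁₂), A := 1/√(Re χ̃), ω := −Im χ̃ / Re χ̃. Then the pair α₁(τ) := A·e^{iωτ}, α₂(τ) := A·e^{−iωτ} (so that α₂ = conj(α₁)) is an exact solution of the amplitude system α₁' = α₁ + (χ₁₁·|α₁|² + χ₁₂·|α₂|²)·α₁, α₂' = α₂ + (conj(χ₁₁)·|α₂|² + conj(χ₁₂)·|α₁|²)·α₂ on all of ℝ. -/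
/-- For `Re(χ₁₁ + χ₁₂) < 0`, with `χ̃ = -(χ₁₁+χ₁₂)`, `A = 1/√(Re χ̃)`,
`ω = -Im χ̃ / Re χ̃`, the pair `α₁(τ) = A e^{iωτ}`, `α₂(τ) = A e^{-iωτ}` (so `α₂ = conj α₁`)
is an exact solution of the amplitude system on all of `ℝ`. -/
theorem stmt_15 (χ₁₁ χ₁₂ : ℂ) (h : (χ₁₁ + χ₁₂).re < 0) :
    let χt : ℂ := -(χ₁₁ + χ₁₂)
    let A : ℝ := 1 / Real.sqrt χt.re
    let ω : ℝ := -χt.im / χt.re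
    let α₁ : ℝ → ℂ := fun τ => (A : ℂ) * Complex.exp (Complex.I * ((ω * τ : ℝ) : ℂ))
    let α₂ : ℝ → ℂ := fun τ => (A : ℂ) * Complex.exp (-(Complex.I * ((ω * τ : ℝ) : ℂ)))
    (∀ τ : ℝ, α₂ τ = (starRingEnd ℂ) (α₁ τ)) ∧
    (∀ τ : ℝ, HasDerivAt α₁
      (α₁ τ + (χ₁₁ * (‖α₁ τ‖ : ℂ) ^ 2 +
        χ₁₂ * (‖α₂ τ‖ : ℂ) ^ 2) * α₁ τ) τ) ∧
    (∀ τ : ℝ, HasDerivAt α₂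
      (α₂ τ + ((starRingEnd ℂ) χ₁₁ * (‖α₂ τ‖ : ℂ) ^ 2 +
        (starRingEnd ℂ) χ₁₂ * (‖α₁ τ‖ : ℂ) ^ 2) * α₂ τ) τ) := by
  intro χt A ω α₁ α₂
  have hre : 0 < χt.re := by
    rw [Complex.neg_re]
    exact neg_pos.mpr h
  have hconj : ∀ τ, α₂ τ = (starRingEnd ℂ) (α₁ τ) := fun τ => by
    simp only [α₁, α₂, map_mul, ← Complex.exp_conj, Complex.conj_ofReal, Complex.conj_I, neg_mul]
  have hnorm₂ : ∀ τ, ‖α₂ τ‖ = ‖α₁ τ‖ := fun τ => by rw [hconj, Complex.norm_conj]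
  have hnorm₁ : ∀ τ, ‖α₁ τ‖ ^ 2 = 1 / χt.re := fun τ => by
    simp only [α₁, A, norm_mul, mul_comm Complex.I, Complex.norm_exp_ofReal_mul_I,
      Complex.norm_real, mul_one, Real.norm_eq_abs, sq_abs, div_pow, one_pow, Real.sq_sqrt hre.le]
  have hsum : χ₁₁ + χ₁₂ = -χt := by simp [χt]
  have hfreq : Complex.I * ω = 1 + (χ₁₁ + χ₁₂) * ((1 / χt.re : ℝ) : ℂ) := by
    have hne : (χt.re : ℂ) ≠ 0 := by exact_mod_cast hre.ne'
    rw [hsum]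
    simp only [ω]
    push_cast
    field_simp
    linear_combination -Complex.re_add_im χt
  have hderiv : ∀ τ : ℝ, HasDerivAt α₁
      (α₁ τ + (χ₁₁ * (‖α₁ τ‖ : ℂ) ^ 2 + χ₁₂ * (‖α₂ τ‖ : ℂ) ^ 2) * α₁ τ) τ := fun τ => by
    have hphase : HasDerivAt (fun t : ℝ => Complex.I * ((ω * t : ℝ) : ℂ)) (Complex.I * ω) τ := by
      simpa using (((hasDerivAt_id τ).const_mul ω).ofReal_comp).const_mul Complex.I
    refine (hphase.cexp.const_mul (A : ℂ)).congr_deriv ?_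
    rw [hnorm₂, ← Complex.ofReal_pow, hnorm₁, hfreq]
    simp only [α₁]
    ring
  refine ⟨hconj, hderiv, fun τ => ?_⟩
  rw [show α₂ = fun t => star (α₁ t) from funext hconj]
  refine (hderiv τ).star.congr_deriv ?_
  simp [hnorm₂]
end
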